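/- The set D of all Dirac measures on {0,1}^∞ is contained in S⁺: for every infinite binary sequence x, there exists a stationary ergodic measure ν with d(δ_x, ν) = 0. -/

import Mathlib

open MeasureTheory Filter

/-- The shift on infinite binary sequences. -/
def shift : (ℕ → Bool) → (ℕ → Bool) := fun y n => y (n + 1)

/-- Probability of the cylinder set of the finite word `w`. -/
noncomputable def cyl (μ : Measure (ℕ → Bool)) (w : List Bool) : ℝ :=
  (μ {y : ℕ → Bool | ∀ i : Fin w.length, y (i : ℕ) = w.get i}).toReal

/-- One summand of the KL divergence between the distributions induced on
length-`n` words, with the conventions `0 · log(0/q) = 0` and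
`p · log(p/0) = ∞` for `p > 0`. -/
noncomputable def klTerm (μ ρ : Measure (ℕ → Bool)) (w : List Bool) : EReal :=
  if cyl μ w = 0 then 0
  else if cyl ρ w = 0 then ⊤
  else ((cyl μ w * Real.logb 2 (cyl μ w / cyl ρ w) : ℝ) : EReal)

/-- Cumulative KL divergence `d_n(μ, ρ) = E_μ[log₂(μ(x_{1..n})/ρ(x_{1..n}))]`. -/
noncomputable def dn (μ ρ : Measure (ℕ → Bool)) (n : ℕ) : EReal :=
  ∑ w : Fin n → Bool, klTerm μ ρ (List.ofFn w)

/-- Expected average KL divergence `d(μ, ρ) = liminf (1/n) d_n(μ, ρ)`. -/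
noncomputable def dKL (μ ρ : Measure (ℕ → Bool)) : EReal :=
  liminf (fun n : ℕ => ((((n : ℝ))⁻¹ : ℝ) : EReal) * dn μ ρ n) atTop

open ProbabilityTheory Topology

section BernoulliShift

variable {α : Type*} [MeasurableSpace α]

/-- The one-sided Bernoulli shift preserves the product measure. -/
theorem measurePreserving_bernoulliShift (p : Measure α) [IsProbabilityMeasure p] :
    MeasurePreserving (fun (u : ℕ → α) n => u (n + 1))
      (Measure.infinitePi fun _ : ℕ => p) (Measure.infinitePi fun _ : ℕ => p) :=
  ⟨by fun_prop,
    Measure.map_infinitePi_infinitePi_of_inj (P := fun _ : ℕ => p) (add_left_injective 1)⟩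

/-- The one-sided Bernoulli shift is ergodic. -/
theorem ergodic_bernoulliShift (p : Measure α) [IsProbabilityMeasure p] :
    Ergodic (fun (u : ℕ → α) n => u (n + 1)) (Measure.infinitePi fun _ : ℕ => p) := by
  refine ⟨measurePreserving_bernoulliShift p, ⟨fun s hs hinv => ?_⟩⟩
  have hiter : ∀ k : ℕ, (fun (u : ℕ → α) n => u (n + k)) ⁻¹' s = s := by
    intro k
    induction k with
    | zero => rfl
    | succ k ih =>
      conv_rhs => rw [← ih, ← hinv]
      ext u
      simp only [Set.mem_preimage]
      rw [show (fun n => u (n + (k + 1))) = fun n => u (n + 1 + k) by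
        funext n; congr 1; omega]
  have hindep : iIndep (fun n : ℕ => MeasurableSpace.comap (fun u : ℕ → α => u n) inferInstance)
      (Measure.infinitePi fun _ : ℕ => p) :=
    iIndepFun_infinitePi (P := fun _ : ℕ => p) (X := fun _ a => a) (fun _ => measurable_id)
  have htail : MeasurableSet[limsup
      (fun n : ℕ => MeasurableSpace.comap (fun u : ℕ → α => u n) inferInstance) atTop] s := by
    rw [limsup_eq_iInf_iSup_of_nat, MeasurableSpace.measurableSet_iInf]
    intro k
    rw [← hiter k]
    suffices h : Measurable[⨆ i, ⨆ (_ : i ≥ k),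
        MeasurableSpace.comap (fun u : ℕ → α => u i) inferInstance]
        (fun (u : ℕ → α) n => u (n + k)) from h hs
    refine @measurable_pi_lambda _ _ _ (_) _ _ fun n => ?_
    refine Measurable.mono (comap_measurable fun u : ℕ → α => u (n + k)) ?_ le_rfl
    exact le_iSup₂_of_le (n + k) (Nat.le_add_left k n) le_rfl
  rw [eventuallyConst_set']
  rcases measure_zero_or_one_of_measurableSet_limsup_atTop
    (fun n => (measurable_pi_apply n).comap_le) hindep htail with h | h
  · exact Or.inl (ae_eq_empty.2 h)
  · refine Or.inr (ae_eq_univ.2 ?_)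
    rwa [prob_compl_eq_zero_iff hs]

end BernoulliShift

/-- The mass function of the law on `ℕ` whose tail is `P(u ≥ k) = 1 / (k + 1) ^ 2`. -/
noncomputable def tailMass (k : ℕ) : ℝ := 1 / ((k : ℝ) + 1) ^ 2 - 1 / ((k : ℝ) + 2) ^ 2

theorem tailMass_eq (k : ℕ) :
    tailMass k = (2 * k + 3) / (((k : ℝ) + 1) ^ 2 * ((k : ℝ) + 2) ^ 2) := by
  unfold tailMass
  field_simp
  ring

theorem tailMass_nonneg (k : ℕ) : 0 ≤ tailMass k := by
  rw [tailMass_eq]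
  positivity

theorem sum_tailMass (n : ℕ) :
    ∑ k ∈ Finset.range n, tailMass k = 1 - 1 / ((n : ℝ) + 1) ^ 2 := by
  have := Finset.sum_range_sub' (fun k : ℕ => 1 / ((k : ℝ) + 1) ^ 2) n
  norm_num [add_assoc] at this
  simpa [tailMass] using this

theorem hasSum_tailMass : HasSum tailMass 1 := by
  rw [hasSum_iff_tendsto_nat_of_nonneg tailMass_nonneg]
  simp_rw [sum_tailMass]
  have h : Tendsto (fun n : ℕ => (1 / ((n : ℝ) + 1)) ^ 2) atTop (𝓝 (0 ^ 2)) :=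
    tendsto_one_div_add_atTop_nhds_zero_nat.pow 2
  simpa [div_pow] using h.const_sub 1

/-- The law on `ℕ` with mass function `tailMass`. -/
noncomputable def tailPMF : PMF ℕ :=
  ⟨fun k => ENNReal.ofReal (tailMass k), by
    rw [ENNReal.summable.hasSum_iff,
      ← ENNReal.ofReal_tsum_of_nonneg tailMass_nonneg hasSum_tailMass.summable,
      hasSum_tailMass.tsum_eq, ENNReal.ofReal_one]⟩

theorem tailPMF_singleton (n : ℕ) :
    tailPMF.toMeasure {n} = ENNReal.ofReal (tailMass n) := by
  rw [PMF.toMeasure_apply_singleton _ _ (measurableSet_singleton n)]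
  rfl

theorem tailPMF_Iio (k : ℕ) :
    tailPMF.toMeasure (Set.Iio k) = ENNReal.ofReal (1 - 1 / ((k : ℝ) + 1) ^ 2) := by
  rw [← sum_tailMass, ENNReal.ofReal_sum_of_nonneg fun i _ => tailMass_nonneg i,
    ← Finset.coe_range, PMF.toMeasure_apply_finset]
  rfl

theorem prod_one_sub_inv_sq (K : ℕ) :
    ∏ j ∈ Finset.range K, (1 - 1 / ((j : ℝ) + 2) ^ 2) = ((K : ℝ) + 2) / (2 * (K + 1)) := by
  induction K with
  | zero => norm_num
  | succ K ih =>
    rw [Finset.prod_range_succ, ih]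
    push_cast
    field_simp
    ring

/-- Sequences in which the block ending at time `n` has length `n + 1`, and no block ending later
meets `[0, n]`. -/
def singleBlock (n : ℕ) : Set (ℕ → ℕ) := {u | u n = n ∧ ∀ k, u (n + 1 + k) < k + 1}

theorem le_infinitePi_singleBlock (n : ℕ) :
    ENNReal.ofReal (tailMass n / 2) ≤
      (Measure.infinitePi fun _ : ℕ => tailPMF.toMeasure) (singleBlock n) := by
  set t : ℕ → Set ℕ := fun i => if i < n then Set.univ else if i = n then {n} else Set.Iio (i - n)
    with ht
  have hset : singleBlock n = Set.univ.pi t := by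
    ext u
    simp only [singleBlock, Set.mem_ofPred_eq, Set.mem_pi, Set.mem_univ, true_implies, ht]
    constructor
    · rintro ⟨h₁, h₂⟩ i
      split_ifs with hi hi'
      · trivial
      · simpa [hi'] using h₁
      · have := h₂ (i - n - 1)
        rw [show n + 1 + (i - n - 1) = i by omega] at this
        simp only [Set.mem_Iio]
        omega
    · intro h
      refine ⟨by simpa using h n, fun k => ?_⟩
      have := h (n + 1 + k)
      rw [if_neg (by omega), if_neg (by omega), Set.mem_Iio] at this
      omega
  have hle : ∀ i, tailPMF.toMeasure (t i) ≤ 1 := fun i => prob_le_one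
  rw [hset, Measure.infinitePi_pi_univ _ fun i => (Set.to_countable _).measurableSet,
    ENNReal.tprod_eq_iInf_prod hle]
  refine le_iInf fun s => ?_
  obtain ⟨K, hK⟩ : ∃ K, s ⊆ Finset.range (n + 1 + K) := by
    refine ⟨s.sup id + 1, fun i hi => Finset.mem_range.2 ?_⟩
    have : i ≤ s.sup id := Finset.le_sup (f := id) hi
    omega
  refine le_trans ?_ (Finset.prod_le_prod_of_subset_of_le_one' hK fun i _ _ => hle i)
  rw [Finset.prod_range_add, Finset.prod_range_succ,
    Finset.prod_eq_one fun i hi => by simp [ht, Finset.mem_range.1 hi], one_mul]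
  have hn : tailPMF.toMeasure (t n) = ENNReal.ofReal (tailMass n) := by
    simp [ht, tailPMF_singleton]
  have htk : ∀ k ∈ Finset.range K, tailPMF.toMeasure (t (n + 1 + k)) =
      ENNReal.ofReal (1 - 1 / ((k : ℝ) + 2) ^ 2) := by
    intro k _
    have : t (n + 1 + k) = Set.Iio (k + 1) := by
      simp only [ht]
      rw [if_neg (by omega), if_neg (by omega), show n + 1 + k - n = k + 1 by omega]
    rw [this, tailPMF_Iio]
    push_cast
    ring_nf
  rw [hn, Finset.prod_congr rfl htk, ← ENNReal.ofReal_prod_of_nonneg, prod_one_sub_inv_sq,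
    ← ENNReal.ofReal_mul (tailMass_nonneg n)]
  · refine ENNReal.ofReal_le_ofReal ?_
    rw [div_eq_mul_one_div]
    refine mul_le_mul_of_nonneg_left ?_ (tailMass_nonneg n)
    rw [div_le_div_iff₀ (by norm_num) (by positivity)]
    linarith
  · intro k _
    rw [sub_nonneg, div_le_one (by positivity)]
    nlinarith [(Nat.cast_nonneg k : (0 : ℝ) ≤ k)]

open scoped Classical in
/-- Read at time `0` the letter of `x` prescribed by the last block covering time `0`, where the
block ending at time `m` covers `[m - u m, m]` and carries the beginning of `x`. -/
noncomputable def blockLetter (x : ℕ → Bool) (u : ℕ → ℕ) : Bool :=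
  decide (∃ M, M ≤ u M ∧ (∀ k, u (M + 1 + k) < M + 1 + k) ∧ x (u M - M) = true)

theorem measurable_blockLetter (x : ℕ → Bool) : Measurable (blockLetter x) := by
  refine measurable_to_bool ?_
  have : blockLetter x ⁻¹' {true} = ⋃ M, ({u : ℕ → ℕ | M ≤ u M} ∩
      ((⋂ k, {u : ℕ → ℕ | u (M + 1 + k) < M + 1 + k}) ∩
        (fun u : ℕ → ℕ => u M) ⁻¹' {a | x (a - M) = true})) := by
    ext u
    simp [blockLetter]
  rw [this]
  refine MeasurableSet.iUnion fun M => (measurableSet_le measurable_const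
    (measurable_pi_apply M)).inter ((MeasurableSet.iInter fun k =>
      measurableSet_lt (measurable_pi_apply _) measurable_const).inter ?_)
  exact measurable_pi_apply M (Set.to_countable _).measurableSet

theorem blockLetter_eq {x : ℕ → Bool} {u : ℕ → ℕ} {M : ℕ} (h : M ≤ u M)
    (hM : ∀ k, u (M + 1 + k) < M + 1 + k) : blockLetter x u = x (u M - M) := by
  have huniq : ∀ N, N ≤ u N → (∀ k, u (N + 1 + k) < N + 1 + k) → N = M := by
    intro N hN hN'
    rcases lt_trichotomy N M with hlt | heq | hlt
    · have := hN' (M - (N + 1))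
      rw [show N + 1 + (M - (N + 1)) = M by omega] at this
      omega
    · exact heq
    · have := hM (N - (M + 1))
      rw [show M + 1 + (N - (M + 1)) = N by omega] at this
      omega
  rw [Bool.eq_iff_iff]
  simp only [blockLetter, decide_eq_true_eq]
  constructor
  · rintro ⟨N, hN, hN', hx⟩
    rwa [huniq N hN hN'] at hx
  · exact fun hx => ⟨M, h, hM, hx⟩

/-- The stationary coding of a sequence of block lengths into a binary sequence. -/
noncomputable def blockCode (x : ℕ → Bool) (u : ℕ → ℕ) : ℕ → Bool :=
  fun i => blockLetter x fun m => u (m + i)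

theorem measurable_blockCode (x : ℕ → Bool) : Measurable (blockCode x) :=
  measurable_pi_lambda _ fun i =>
    (measurable_blockLetter x).comp (measurable_pi_lambda _ fun m => measurable_pi_apply (m + i))

theorem blockCode_semiconj (x : ℕ → Bool) :
    Function.Semiconj (blockCode x) (fun u n => u (n + 1)) shift :=
  fun _ => rfl

theorem blockCode_eq_of_mem_singleBlock {x : ℕ → Bool} {u : ℕ → ℕ} {n i : ℕ}
    (hu : u ∈ singleBlock n) (hi : i ≤ n) : blockCode x u i = x i := by
  obtain ⟨h₁, h₂⟩ := hu
  have key : u (n - i + i) = n := by rw [Nat.sub_add_cancel hi, h₁]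
  have := blockLetter_eq (x := x) (u := fun m => u (m + i)) (M := n - i)
    (by simp only [key]; omega) fun k => by
      have := h₂ k
      simp only [show n - i + 1 + k + i = n + 1 + k by omega]
      omega
  rw [blockCode, this]
  simp only [key]
  congr 1
  omega

/-- The law of the coded binary sequence when the block lengths are independent with law
`tailPMF`. -/
noncomputable def blockMeasure (x : ℕ → Bool) : Measure (ℕ → Bool) :=
  (Measure.infinitePi fun _ : ℕ => tailPMF.toMeasure).map (blockCode x)

instance (x : ℕ → Bool) : IsProbabilityMeasure (blockMeasure x) :=
  Measure.isProbabilityMeasure_map (measurable_blockCode x).aemeasurable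

theorem measurable_shift : Measurable shift :=
  measurable_pi_lambda _ fun n => measurable_pi_apply (n + 1)

theorem ergodic_blockMeasure (x : ℕ → Bool) : Ergodic shift (blockMeasure x) :=
  ((measurable_blockCode x).measurePreserving _).ergodic_of_ergodic_semiconj
    (ergodic_bernoulliShift tailPMF.toMeasure) measurable_shift (blockCode_semiconj x)

theorem cyl_ofFn (μ : Measure (ℕ → Bool)) {n : ℕ} (w : Fin n → Bool) :
    cyl μ (List.ofFn w) = μ.real {y : ℕ → Bool | ∀ i : Fin n, y i = w i} := by
  rw [cyl, Measure.real]
  congr 2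
  ext y
  simp only [Set.mem_ofPred_eq]
  constructor
  · intro h i
    simpa using h ⟨i, by simp⟩
  · intro h i
    simpa using h ⟨i, by simpa using i.2⟩

theorem measurableSet_cylinder_word {n : ℕ} (w : Fin n → Bool) :
    MeasurableSet {y : ℕ → Bool | ∀ i : Fin n, y i = w i} := by
  rw [Set.ofPred_forall]
  exact MeasurableSet.iInter fun i => measurableSet_eq_fun (measurable_pi_apply (i : ℕ)) measurable_const

theorem dn_dirac (x : ℕ → Bool) (ρ : Measure (ℕ → Bool)) (n : ℕ)
    (h : cyl ρ (List.ofFn fun i : Fin n => x i) ≠ 0) :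
    dn (Measure.dirac x) ρ n =
      ((-Real.logb 2 (cyl ρ (List.ofFn fun i : Fin n => x i)) : ℝ) : EReal) := by
  have hcyl : ∀ w : Fin n → Bool, cyl (Measure.dirac x) (List.ofFn w) =
      if (fun i : Fin n => x i) = w then 1 else 0 := by
    intro w
    rw [cyl_ofFn, Measure.real, Measure.dirac_apply' _ (measurableSet_cylinder_word w)]
    by_cases hw : (fun i : Fin n => x i) = w
    · subst hw
      simp
    · have : ¬ ∀ i : Fin n, x i = w i := fun h' => hw (funext h')
      simp [hw, this]
  rw [dn, Finset.sum_eq_single fun i : Fin n => x i]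
  · rw [klTerm, hcyl, if_pos rfl, if_neg one_ne_zero, if_neg h]
    simp
  · intro w _ hw
    rw [klTerm, hcyl, if_neg hw.symm, if_pos rfl]
  · simp

theorem le_cyl_blockMeasure (x : ℕ → Bool) (n : ℕ) :
    tailMass n / 2 ≤ cyl (blockMeasure x) (List.ofFn fun i : Fin n => x i) := by
  rw [cyl_ofFn, Measure.real, ← ENNReal.ofReal_le_iff_le_toReal (measure_ne_top _ _),
    blockMeasure, Measure.map_apply (measurable_blockCode x) (measurableSet_cylinder_word _)]
  exact (le_infinitePi_singleBlock n).trans (measure_mono fun u hu i =>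
    blockCode_eq_of_mem_singleBlock hu i.2.le)

theorem inv_pow_le_tailMass (n : ℕ) : (((n : ℝ) + 2) ^ 4)⁻¹ ≤ tailMass n / 2 := by
  rw [tailMass_eq, div_div, inv_eq_one_div, div_le_div_iff₀ (by positivity) (by positivity)]
  have hn : (0 : ℝ) ≤ n := Nat.cast_nonneg n
  have : ((n : ℝ) + 1) ^ 2 * 2 ≤ (2 * n + 3) * ((n : ℝ) + 2) ^ 2 := by nlinarith [pow_nonneg hn 3]
  nlinarith [mul_le_mul_of_nonneg_right this (sq_nonneg ((n : ℝ) + 2))]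

theorem tendsto_logb_add_two_div :
    Tendsto (fun n : ℕ => (n : ℝ)⁻¹ * (4 * Real.logb 2 ((n : ℝ) + 2))) atTop (𝓝 0) := by
  have h := (Real.tendsto_pow_logb_div_mul_add_atTop (b := 2) 1 (-2) 1 one_ne_zero).comp
    ((tendsto_natCast_atTop_atTop (R := ℝ)).atTop_add (tendsto_const_nhds (x := (2 : ℝ))))
  have h' := h.const_mul 4
  rw [mul_zero] at h'
  refine h'.congr fun n => ?_
  simp only [Function.comp_apply, pow_one]
  rw [show (1 : ℝ) * (n + 2) + -2 = n by ring]
  ring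

theorem dKL_dirac_blockMeasure (x : ℕ → Bool) : dKL (Measure.dirac x) (blockMeasure x) = 0 := by
  set c : ℕ → ℝ := fun n => cyl (blockMeasure x) (List.ofFn fun i : Fin n => x i) with hc
  have hlow : ∀ n : ℕ, (((n : ℝ) + 2) ^ 4)⁻¹ ≤ c n := fun n =>
    (inv_pow_le_tailMass n).trans (le_cyl_blockMeasure x n)
  have hpos : ∀ n, 0 < c n := fun n => lt_of_lt_of_le (by positivity) (hlow n)
  have hle : ∀ n, c n ≤ 1 := fun n => by
    simp only [hc, cyl_ofFn]
    exact measureReal_le_one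
  have hreal : Tendsto (fun n : ℕ => (n : ℝ)⁻¹ * -Real.logb 2 (c n)) atTop (𝓝 0) := by
    refine squeeze_zero (fun n => ?_) (fun n => ?_) tendsto_logb_add_two_div
    · exact mul_nonneg (by positivity)
        (neg_nonneg.2 (Real.logb_nonpos one_lt_two (hpos n).le (hle n)))
    · refine mul_le_mul_of_nonneg_left ?_ (by positivity)
      have := Real.logb_le_logb_of_le one_lt_two (by positivity) (hlow n)
      rw [Real.logb_inv, Real.logb_pow] at this
      push_cast at this
      linarith
  rw [dKL]
  refine Tendsto.liminf_eq ?_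
  refine (EReal.tendsto_coe.2 hreal).congr fun n => ?_
  rw [dn_dirac x _ n (hpos n).ne', EReal.coe_mul]

/-- every Dirac measure `δ_x` on `{0,1}^∞` belongs to `S⁺`:
there is a stationary ergodic probability measure `ν` with `d(δ_x, ν) = 0`. -/
theorem stmt14 (x : ℕ → Bool) :
    ∃ ν : Measure (ℕ → Bool), IsProbabilityMeasure ν ∧
      MeasurePreserving shift ν ν ∧ Ergodic shift ν ∧
      dKL (Measure.dirac x) ν = 0 :=
  ⟨blockMeasure x, inferInstance, (ergodic_blockMeasure x).toMeasurePreserving,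
    ergodic_blockMeasure x, dKL_dirac_blockMeasure x⟩
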